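/- If (a_n)_{n≥1} is a strong divisibility sequence in a GCD domain R (i.e., gcd(a_m, a_n) is associated to a_{gcd(m,n)} for all m,n ≥ 1), then there exists a unique (up to units) sequence (b_n)_{n≥1} of nonzero elements of R such that a_n = ∏_{d | n} b_d for all n ≥ 1. -/

import Mathlib

open Classical in
/-- The primitive part sequence, defined recursively. -/
noncomputable def sdsB {R : Type*} [CommRing R] (a : ℕ → R) (n : ℕ) : R :=
  if h : (∏ d ∈ n.properDivisors.attach, sdsB a d.1) ∣ a n then h.choose else 0
termination_by n
decreasing_by exact (Nat.mem_properDivisors.1 d.2).2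

theorem sdsB_spec {R : Type*} [CommRing R] (a : ℕ → R) (n : ℕ)
    (h : (∏ d ∈ n.properDivisors, sdsB a d) ∣ a n) :
    a n = (∏ d ∈ n.properDivisors, sdsB a d) * sdsB a n := by
  have h' : (∏ d ∈ n.properDivisors.attach, sdsB a d.1) ∣ a n := by
    rwa [Finset.prod_attach n.properDivisors (fun d => sdsB a d)]
  have e : sdsB a n = h'.choose := by
    rw [sdsB, dif_pos h']
  rw [e, ← Finset.prod_attach n.properDivisors (fun d => sdsB a d)]
  exact h'.choose_spec

theorem sds_prod_divisors {R : Type*} [CommRing R] (b : ℕ → R) (n : ℕ) (hn : 1 ≤ n) :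
    ∏ d ∈ n.divisors, b d = (∏ d ∈ n.properDivisors, b d) * b n := by
  rw [← Nat.insert_self_properDivisors (by omega), Finset.prod_insert (by simp), mul_comm]

theorem sds_relPrime {R : Type*} [CommRing R] [IsDomain R] [GCDMonoid R]
    (a b : ℕ → R) (ha : ∀ n, 1 ≤ n → a n ≠ 0)
    (hsd : ∀ m n, 1 ≤ m → 1 ≤ n → Associated (gcd (a m) (a n)) (a (Nat.gcd m n)))
    (N : ℕ) (hb : ∀ n, 1 ≤ n → n < N → a n = ∏ d ∈ n.divisors, b d)
    (i j : ℕ) (hi : 1 ≤ i) (hj : 1 ≤ j) (hiN : i < N) (hjN : j < N)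
    (hij : ¬ i ∣ j) (hji : ¬ j ∣ i) : IsRelPrime (b i) (b j) := by
  have hg : 1 ≤ Nat.gcd i j := Nat.gcd_pos_of_pos_left _ hi
  have key : ∀ k, 1 ≤ k → k < N → Nat.gcd i j ∣ k → ¬ k ∣ Nat.gcd i j →
      a (Nat.gcd i j) * b k ∣ a k := by
    intro k hk hkN hgk hkg
    have hle := Nat.le_of_dvd hk hgk
    rw [hb _ hg (by omega), hb k hk hkN, mul_comm,
      ← Finset.prod_insert (s := (Nat.gcd i j).divisors) (f := b) (a := k)
        (fun h => hkg (Nat.dvd_of_mem_divisors h))]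
    apply Finset.prod_dvd_prod_of_subset
    intro d hd
    rw [Finset.mem_insert] at hd
    rw [Nat.mem_divisors]
    rcases hd with rfl | hd
    · exact ⟨dvd_rfl, by omega⟩
    · exact ⟨(Nat.dvd_of_mem_divisors hd).trans hgk, by omega⟩
  intro t hti htj
  have h1 := (mul_dvd_mul_left (a (Nat.gcd i j)) hti).trans
    (key i hi hiN (Nat.gcd_dvd_left _ _) (fun h => hij (h.trans (Nat.gcd_dvd_right _ _))))
  have h2 := (mul_dvd_mul_left (a (Nat.gcd i j)) htj).trans
    (key j hj hjN (Nat.gcd_dvd_right _ _) (fun h => hji (h.trans (Nat.gcd_dvd_left _ _))))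
  have h3 := (dvd_gcd h1 h2).trans (hsd i j hi hj).dvd
  have h4 : a (Nat.gcd i j) * t ∣ a (Nat.gcd i j) * 1 := by rwa [mul_one]
  exact isUnit_of_dvd_one ((mul_dvd_mul_iff_left (ha _ hg)).1 h4)

theorem sds_prod_dvd {R : Type*} [CommRing R] [IsDomain R] [GCDMonoid R]
    (a b : ℕ → R) (ha : ∀ n, 1 ≤ n → a n ≠ 0)
    (hsd : ∀ m n, 1 ≤ m → 1 ≤ n → Associated (gcd (a m) (a n)) (a (Nat.gcd m n)))
    (N : ℕ) (hb : ∀ n, 1 ≤ n → n < N → a n = ∏ d ∈ n.divisors, b d) (x : R)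
    (S : Finset ℕ) : (∀ d ∈ S, 1 ≤ d ∧ d < N ∧ a d ∣ x) →
      (∀ d ∈ S, ∀ e, e ∣ d → e ∈ S) → ∏ d ∈ S, b d ∣ x := by
  induction S using Finset.induction_on_max with
  | empty => simp
  | insert m T hT ih =>
    intro h1 h2
    have hmT : m ∉ T := fun h => lt_irrefl _ (hT m h)
    obtain ⟨hm, hmN, hmx⟩ := h1 m (Finset.mem_insert_self _ _)
    have hTx : ∏ d ∈ T, b d ∣ x := by
      apply ih (fun d hd => h1 d (Finset.mem_insert_of_mem hd))
      intro d hd e he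
      have hd1 := (h1 d (Finset.mem_insert_of_mem hd)).1
      have := h2 d (Finset.mem_insert_of_mem hd) e he
      rcases Finset.mem_insert.1 this with rfl | h
      · have := Nat.le_of_dvd hd1 he
        have := hT d hd
        omega
      · exact h
    have hD : m.properDivisors ⊆ T := by
      intro d hd
      rw [Nat.mem_properDivisors] at hd
      rcases Finset.mem_insert.1 (h2 m (Finset.mem_insert_self _ _) d hd.1) with h | h
      · omega
      · exact h
    have ham := hb m hm hmN
    rw [sds_prod_divisors b m hm] at ham
    have hP : (∏ d ∈ m.properDivisors, b d) ≠ 0 := by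
      intro h0
      apply ha m hm
      rw [ham, h0, zero_mul]
    rw [Finset.prod_insert hmT, ← Finset.prod_sdiff hD]
    rw [← Finset.prod_sdiff hD, mul_comm] at hTx
    rw [ham] at hmx
    obtain ⟨y, rfl⟩ := (dvd_mul_right _ _).trans hmx
    have hy1 := (mul_dvd_mul_iff_left hP).1 hmx
    have hy2 := (mul_dvd_mul_iff_left hP).1 hTx
    have hrel : IsRelPrime (∏ d ∈ T \ m.properDivisors, b d) (b m) := by
      apply IsRelPrime.prod_left
      intro d hd
      rw [Finset.mem_sdiff, Nat.mem_properDivisors] at hd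
      have hdm := hT d hd.1
      obtain ⟨hd1, hdN, -⟩ := h1 d (Finset.mem_insert_of_mem hd.1)
      refine sds_relPrime a b ha hsd N hb d m hd1 hm hdN hmN (fun h => hd.2 ⟨h, hdm⟩) ?_
      intro h
      have := Nat.le_of_dvd hd1 h
      omega
    have := mul_dvd_mul_left (∏ d ∈ m.properDivisors, b d) (hrel.mul_dvd hy2 hy1)
    convert this using 1
    ring

/-- If `(a n)` is a strong divisibility sequence in a GCD domain, then there is a
sequence `(b n)` of nonzero elements, unique up to units, with
`a n = ∏_{d ∣ n} b d` for all `n ≥ 1`. -/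
theorem strong_divisibility_special {R : Type*} [CommRing R] [IsDomain R] [GCDMonoid R]
    (a : ℕ → R) (ha : ∀ n, 1 ≤ n → a n ≠ 0)
    (hsd : ∀ m n, 1 ≤ m → 1 ≤ n → Associated (gcd (a m) (a n)) (a (Nat.gcd m n))) :
    ∃ b : ℕ → R,
      (∀ n, 1 ≤ n → b n ≠ 0) ∧
      (∀ n, 1 ≤ n → a n = ∏ d ∈ n.divisors, b d) ∧
      (∀ b' : ℕ → R, (∀ n, 1 ≤ n → b' n ≠ 0) →
        (∀ n, 1 ≤ n → a n = ∏ d ∈ n.divisors, b' d) →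
        ∀ n, 1 ≤ n → Associated (b' n) (b n)) := by
  have main : ∀ n, 1 ≤ n → a n = ∏ d ∈ n.divisors, sdsB a d := by
    intro n
    induction n using Nat.strong_induction_on with
    | _ n ih =>
      intro hn
      rw [sds_prod_divisors _ n hn]
      apply sdsB_spec
      apply sds_prod_dvd a (sdsB a) ha hsd n (fun k hk hkn => ih k hkn hk)
      · intro d hd
        have hd1 := Nat.pos_of_mem_properDivisors hd
        rw [Nat.mem_properDivisors] at hd
        refine ⟨hd1, hd.2, ?_⟩
        have := (hsd d n hd1 hn).symm.dvd.trans (gcd_dvd_right _ _)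
        rwa [Nat.gcd_eq_left hd.1] at this
      · intro d hd e he
        have hd1 := Nat.pos_of_mem_properDivisors hd
        rw [Nat.mem_properDivisors] at hd ⊢
        exact ⟨he.trans hd.1, (Nat.le_of_dvd hd1 he).trans_lt hd.2⟩
  have hne : ∀ n, 1 ≤ n → sdsB a n ≠ 0 := by
    intro n hn h0
    apply ha n hn
    rw [main n hn, sds_prod_divisors _ n hn, h0, mul_zero]
  refine ⟨sdsB a, hne, main, ?_⟩
  intro b' hb' hp n
  induction n using Nat.strong_induction_on with
  | _ n ih =>
    intro hn
    have h1 : Associated (∏ d ∈ n.properDivisors, b' d) (∏ d ∈ n.properDivisors, sdsB a d) := by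
      apply Associated.prod
      intro d hd
      exact ih d (Nat.mem_properDivisors.1 hd).2 (Nat.pos_of_mem_properDivisors hd)
    have h2 : (∏ d ∈ n.properDivisors, b' d) * b' n =
        (∏ d ∈ n.properDivisors, sdsB a d) * sdsB a n := by
      rw [← sds_prod_divisors _ n hn, ← sds_prod_divisors _ n hn, ← hp n hn, ← main n hn]
    refine Associated.of_mul_left (Associated.of_eq h2) h1 ?_
    exact Finset.prod_ne_zero_iff.2 fun d hd => hb' d (Nat.pos_of_mem_properDivisors hd)
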